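/- arXiv:1905.10122 — 10 statements merged into one kernel-verified Lean document; each statement's English description precedes it below -/
import Mathlib

section
/- Let x, y, z be real numbers with 0 < x < y < z. Then ψ₁² + 4ψ₀ > 0, 0 < s₀ < s₁, and 0 < ρ < 1; in particular, ξ_{x,y,z} = ρ·δ_{s₀} + (1−ρ)·δ_{s₁} is a Borel probability measure on ℝ whose support consists of exactly two distinct points, both lying in (0,∞). -/
open MeasureTheory

noncomputable def psi0 (x y z : ℝ) : ℝ := -(x^2 * y^2 * (z^2 - y^2) / (y^2 - x^2))

noncomputable def psi1 (x y z : ℝ) : ℝ := y^2 * (z^2 - x^2) / (y^2 - x^2)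

noncomputable def s0 (x y z : ℝ) : ℝ :=
  (psi1 x y z - Real.sqrt ((psi1 x y z)^2 + 4 * psi0 x y z)) / 2

noncomputable def s1 (x y z : ℝ) : ℝ :=
  (psi1 x y z + Real.sqrt ((psi1 x y z)^2 + 4 * psi0 x y z)) / 2

noncomputable def rho (x y z : ℝ) : ℝ := (s1 x y z - x^2) / (s1 x y z - s0 x y z)

/-- The Berger measure associated with the Stampfli completion of `(x,y,z)`. -/
noncomputable def xi (x y z : ℝ) : Measure ℝ :=
  ENNReal.ofReal (rho x y z) • Measure.dirac (s0 x y z) +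
    ENNReal.ofReal (1 - rho x y z) • Measure.dirac (s1 x y z)

/-- A convex combination of Dirac masses at two distinct points, with both weights positive,
is a probability measure carried by exactly these two points. -/
theorem two_atoms {r a b : ℝ} (hr : 0 < r) (hr1 : r < 1) (hab : a ≠ b) {μ : Measure ℝ}
    (hμ : μ = ENNReal.ofReal r • Measure.dirac a + ENNReal.ofReal (1 - r) • Measure.dirac b) :
    IsProbabilityMeasure μ ∧ μ {a} ≠ 0 ∧ μ {b} ≠ 0 ∧ μ (({a, b} : Set ℝ)ᶜ) = 0 := by
  subst hμ
  refine ⟨⟨?_⟩, ?_, ?_, ?_⟩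
  · simp [← ENNReal.ofReal_add hr.le (sub_pos.2 hr1).le]
  · simp [hab.symm, hr]
  · simp [hab, hr1]
  · simp

section Quadratic

variable {x y z : ℝ}

theorem psi1_pos (hx : 0 < x) (hxy : x < y) (hyz : y < z) : 0 < psi1 x y z := by
  have h1 : 0 < y ^ 2 - x ^ 2 := by nlinarith
  have h2 : 0 < z ^ 2 - x ^ 2 := by nlinarith
  have hy : 0 < y := hx.trans hxy
  unfold psi1
  positivity

theorem psi0_neg (hx : 0 < x) (hxy : x < y) (hyz : y < z) : psi0 x y z < 0 := by
  have h1 : 0 < y ^ 2 - x ^ 2 := by nlinarith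
  have h2 : 0 < z ^ 2 - y ^ 2 := by nlinarith
  have hy : 0 < y := hx.trans hxy
  unfold psi0
  rw [neg_lt_zero]
  positivity

theorem discriminant_eq (hx : 0 < x) (hxy : x < y) :
    psi1 x y z ^ 2 + 4 * psi0 x y z =
      (psi1 x y z - 2 * x ^ 2) ^ 2 + 4 * (x ^ 2 * (y ^ 2 - x ^ 2)) := by
  have h1 : y ^ 2 - x ^ 2 ≠ 0 := by nlinarith
  unfold psi0 psi1
  field_simp
  ring

theorem discriminant_pos (hx : 0 < x) (hxy : x < y) :
    0 < psi1 x y z ^ 2 + 4 * psi0 x y z := by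
  have h1 : 0 < y ^ 2 - x ^ 2 := by nlinarith
  rw [discriminant_eq hx hxy]
  positivity

theorem s0_pos (hx : 0 < x) (hxy : x < y) (hyz : y < z) : 0 < s0 x y z := by
  have h : √(psi1 x y z ^ 2 + 4 * psi0 x y z) < psi1 x y z := by
    rw [Real.sqrt_lt' (psi1_pos hx hxy hyz)]
    linarith [psi0_neg hx hxy hyz]
  unfold s0
  linarith

theorem abs_psi1_sub_lt_sqrt (hx : 0 < x) (hxy : x < y) :
    |psi1 x y z - 2 * x ^ 2| < √(psi1 x y z ^ 2 + 4 * psi0 x y z) := by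
  have h1 : 0 < y ^ 2 - x ^ 2 := by nlinarith
  apply Real.lt_sqrt_of_sq_lt
  rw [sq_abs, discriminant_eq hx hxy, lt_add_iff_pos_right]
  positivity

theorem s0_lt_sq (hx : 0 < x) (hxy : x < y) : s0 x y z < x ^ 2 := by
  have h := (abs_lt.1 (abs_psi1_sub_lt_sqrt (z := z) hx hxy)).2
  unfold s0
  linarith

theorem sq_lt_s1 (hx : 0 < x) (hxy : x < y) : x ^ 2 < s1 x y z := by
  have h := (abs_lt.1 (abs_psi1_sub_lt_sqrt (z := z) hx hxy)).1
  unfold s1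
  linarith

end Quadratic

theorem stmt0 (x y z : ℝ) (hx : 0 < x) (hxy : x < y) (hyz : y < z) :
    0 < (psi1 x y z)^2 + 4 * psi0 x y z ∧
    0 < s0 x y z ∧ s0 x y z < s1 x y z ∧
    0 < rho x y z ∧ rho x y z < 1 ∧
    IsProbabilityMeasure (xi x y z) ∧
    xi x y z {s0 x y z} ≠ 0 ∧ xi x y z {s1 x y z} ≠ 0 ∧
    xi x y z (({s0 x y z, s1 x y z} : Set ℝ)ᶜ) = 0 := by
  have h0 := s0_lt_sq (z := z) hx hxy
  have h1 := sq_lt_s1 (z := z) hx hxy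
  have h01 := h0.trans h1
  have hr : 0 < rho x y z := div_pos (sub_pos.2 h1) (sub_pos.2 h01)
  have hr1 : rho x y z < 1 := (div_lt_one (sub_pos.2 h01)).2 (by linarith)
  exact ⟨discriminant_pos hx hxy, s0_pos hx hxy hyz, h01, hr, hr1, two_atoms hr hr1 h01.ne rfl⟩
end

section
/- Let x, y, z be real numbers with 0 < x < y < z. Then ∫ (1/s) dξ_{x,y,z}(s) = (x⁴ − 2x²y² + y²z²)/(x²y²(z²−y²)). -/
open MeasureTheory

/-- The generating polynomial is `-x²(y² - x²) < 0` at `x²`, expressed via the discriminant. -/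
theorem psi1_sq_add_four_mul_psi0 {x y : ℝ} (z : ℝ) (h : y ^ 2 - x ^ 2 ≠ 0) :
    psi1 x y z ^ 2 + 4 * psi0 x y z =
      (2 * x ^ 2 - psi1 x y z) ^ 2 + 4 * (x ^ 2 * (y ^ 2 - x ^ 2)) := by
  unfold psi0 psi1
  field_simp
  ring

theorem s0_add_s1 (x y z : ℝ) : s0 x y z + s1 x y z = psi1 x y z := by
  unfold s0 s1
  ring

theorem s0_mul_s1 {x y z : ℝ} (h : 0 ≤ psi1 x y z ^ 2 + 4 * psi0 x y z) :
    s0 x y z * s1 x y z = -psi0 x y z := by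
  unfold s0 s1
  linear_combination (-1 / 4 : ℝ) * Real.sq_sqrt h

theorem integral_ofReal_smul_dirac_add {p q : ℝ} (hp : 0 ≤ p) (hq : 0 ≤ q) (a b : ℝ)
    (f : ℝ → ℝ) :
    ∫ s, f s ∂(ENNReal.ofReal p • Measure.dirac a + ENNReal.ofReal q • Measure.dirac b) =
      p * f a + q * f b := by
  have hf (c r : ℝ) : Integrable f (ENNReal.ofReal r • Measure.dirac c) :=
    (integrable_dirac (by simp)).smul_measure ENNReal.ofReal_ne_top
  rw [integral_add_measure (hf a p) (hf b q)]
  simp [integral_smul_measure, ENNReal.toReal_ofReal, hp, hq]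

theorem stmt1 (x y z : ℝ) (hx : 0 < x) (hxy : x < y) (hyz : y < z) :
    ∫ s, 1 / s ∂(xi x y z) =
      (x^4 - 2 * x^2 * y^2 + y^2 * z^2) / (x^2 * y^2 * (z^2 - y^2)) := by
  have hxy2 : 0 < y ^ 2 - x ^ 2 := by nlinarith
  have hyz2 : 0 < z ^ 2 - y ^ 2 := by nlinarith
  have hy : 0 < y := hx.trans hxy
  have hdisc := psi1_sq_add_four_mul_psi0 z hxy2.ne'
  have hgap : 0 < x ^ 2 * (y ^ 2 - x ^ 2) := by positivity
  have habs : |2 * x ^ 2 - psi1 x y z| < √(psi1 x y z ^ 2 + 4 * psi0 x y z) := by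
    apply Real.lt_sqrt_of_sq_lt
    rw [sq_abs]
    linarith
  obtain ⟨hlow, hupp⟩ := abs_lt.mp habs
  have h0 : s0 x y z < x ^ 2 := by unfold s0; linarith
  have h1 : x ^ 2 < s1 x y z := by unfold s1; linarith
  have hlt : 0 < s1 x y z - s0 x y z := by linarith
  have hsum := s0_add_s1 x y z
  have hprod : s0 x y z * s1 x y z = -psi0 x y z :=
    s0_mul_s1 (by rw [hdisc]; positivity)
  have hpsi0 : 0 < -psi0 x y z := by
    rw [psi0, neg_neg]
    positivity
  have hne : s0 x y z * s1 x y z ≠ 0 := by rw [hprod]; exact hpsi0.ne'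
  have hs0 := left_ne_zero_of_mul hne
  have hs1 := right_ne_zero_of_mul hne
  have hrho0 : 0 ≤ rho x y z := div_nonneg (by linarith) hlt.le
  have hrho1 : 0 ≤ 1 - rho x y z := by
    rw [rho, sub_nonneg, div_le_one hlt]
    linarith
  have hmean : rho x y z * (s1 x y z - s0 x y z) = s1 x y z - x ^ 2 :=
    div_mul_cancel₀ _ hlt.ne'
  rw [xi, integral_ofReal_smul_dirac_add hrho0 hrho1]
  calc rho x y z * (1 / s0 x y z) + (1 - rho x y z) * (1 / s1 x y z)
      = (psi1 x y z - x ^ 2) / (s0 x y z * s1 x y z) := by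
        field_simp
        linear_combination hmean + hsum
    _ = (psi1 x y z - x ^ 2) / -psi0 x y z := by rw [hprod]
    _ = _ := by
        unfold psi0 psi1
        field_simp
        ring
end

section
/- Let x, y, z be real numbers with 0 < x < y < z. Then ∫ (1/s²) dξ_{x,y,z}(s) = (−x⁶ + y²z⁴ + x⁴(y² + 2z²) + x²(y⁴ − 4y²z²))/(x⁴(y³ − yz²)²). -/
open MeasureTheory

/-- The mean of `1 / s ^ 2` against a two-point measure with mean `a`, in terms of the
sum and product of its atoms. -/
lemma two_point_inv_sq_moment {u v a : ℝ} (hu : u ≠ 0) (hv : v ≠ 0) (huv : u < v) :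
    (v - a) / (v - u) * (1 / u ^ 2) + (1 - (v - a) / (v - u)) * (1 / v ^ 2) =
      ((u + v) * (u + v - a) - u * v) / (u * v) ^ 2 := by
  have h : v - u ≠ 0 := (sub_pos.2 huv).ne'
  field_simp
  ring

lemma integral_add_smul_dirac {p q u v : ℝ} (hp : 0 ≤ p) (hq : 0 ≤ q) (f : ℝ → ℝ) :
    ∫ s, f s ∂(ENNReal.ofReal p • Measure.dirac u + ENNReal.ofReal q • Measure.dirac v) =
      p * f u + q * f v := by
  rw [integral_add_measure ((integrable_dirac (by simp)).smul_measure ENNReal.ofReal_ne_top)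
    ((integrable_dirac (by simp)).smul_measure ENNReal.ofReal_ne_top)]
  simp [integral_smul_measure, ENNReal.toReal_ofReal, hp, hq]

theorem stmt2 (x y z : ℝ) (hx : 0 < x) (hxy : x < y) (hyz : y < z) :
    ∫ s, 1 / s^2 ∂(xi x y z) =
      (-x^6 + y^2 * z^4 + x^4 * (y^2 + 2 * z^2) + x^2 * (y^4 - 4 * y^2 * z^2)) /
        (x^4 * (y^3 - y * z^2)^2) := by
  have ha : 0 < x ^ 2 := by positivity
  have hab : 0 < y ^ 2 - x ^ 2 := by nlinarith
  have hbc : 0 < z ^ 2 - y ^ 2 := by nlinarith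
  have hy : 0 < y := hx.trans hxy
  have hP : 0 < -psi0 x y z := by
    unfold psi0
    rw [neg_neg]
    positivity
  have hmoment : x ^ 2 * psi1 x y z + psi0 x y z = x ^ 2 * y ^ 2 := by
    unfold psi0 psi1
    field_simp
    ring
  have hdisc : 0 ≤ psi1 x y z ^ 2 + 4 * psi0 x y z := by
    nlinarith [sq_nonneg (psi1 x y z - 2 * x ^ 2), mul_pos ha hab]
  have hsum : s0 x y z + s1 x y z = psi1 x y z := by
    unfold s0 s1
    ring
  have hprod : s0 x y z * s1 x y z = -psi0 x y z := by
    unfold s0 s1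
    linear_combination (-1 / 4) * Real.sq_sqrt hdisc
  have hle : s0 x y z ≤ s1 x y z := by
    unfold s0 s1
    linarith [Real.sqrt_nonneg (psi1 x y z ^ 2 + 4 * psi0 x y z)]
  have hneg : (x ^ 2 - s0 x y z) * (x ^ 2 - s1 x y z) < 0 := by
    have : (x ^ 2 - s0 x y z) * (x ^ 2 - s1 x y z) = -(x ^ 2 * (y ^ 2 - x ^ 2)) := by
      linear_combination hprod - x ^ 2 * hsum - hmoment
    rw [this]
    exact neg_neg_of_pos (mul_pos ha hab)
  obtain ⟨h0, h1⟩ : s0 x y z < x ^ 2 ∧ x ^ 2 < s1 x y z := by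
    rcases mul_neg_iff.1 hneg with h | h <;> constructor <;> linarith [h.1, h.2]
  have hs : s0 x y z < s1 x y z := h0.trans h1
  have hd : 0 < s1 x y z - s0 x y z := sub_pos.2 hs
  have hs0 : s0 x y z ≠ 0 := fun h => by simp [h] at hprod; linarith
  have hrho : 0 ≤ rho x y z := div_nonneg (sub_pos.2 h1).le hd.le
  have hrho' : 0 ≤ 1 - rho x y z := by
    rw [sub_nonneg, rho, div_le_one hd]
    linarith
  rw [xi, integral_add_smul_dirac hrho hrho' (fun s => 1 / s ^ 2), rho,
    two_point_inv_sq_moment hs0 (ha.trans h1).ne' hs, hsum, hprod]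
  have hden : y ^ 3 - y * z ^ 2 ≠ 0 := by
    have : y ^ 3 - y * z ^ 2 = -(y * (z ^ 2 - y ^ 2)) := by ring
    rw [this]
    exact neg_ne_zero.2 (mul_pos hy hbc).ne'
  have hP' := hP.ne'
  rw [div_eq_div_iff (pow_ne_zero 2 hP') (mul_ne_zero (by positivity) (pow_ne_zero 2 hden))]
  unfold psi0 psi1
  field_simp
  ring
end

section
/- The image of Ω under f equals the interval (1,∞); that is, f(u,v) > 1 for every (u,v) ∈ Ω, and for every real r > 1 there exists (u,v) ∈ Ω with f(u,v) = r. -/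
/-- `f(u,v) = (1-2u+uv)/(u(v-u))` on `Ω = {(u,v) : v > u > 1}`. -/
noncomputable def fOmega (u v : ℝ) : ℝ := (1 - 2*u + u*v) / (u * (v - u))

theorem fOmega_eq_one_add {u v : ℝ} (hu : u ≠ 0) (huv : v - u ≠ 0) :
    fOmega u v = 1 + (u - 1) ^ 2 / (u * (v - u)) := by
  unfold fOmega
  field_simp
  ring

theorem stmt4 :
    (∀ u v : ℝ, 1 < u → u < v → 1 < fOmega u v) ∧
    (∀ r : ℝ, 1 < r → ∃ u v : ℝ, 1 < u ∧ u < v ∧ fOmega u v = r) := by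
  refine ⟨fun u v hu huv => ?_, fun r hr => ?_⟩
  · have hu0 : 0 < u := by linarith
    have hvu : 0 < v - u := sub_pos.mpr huv
    have hu1 : 0 < u - 1 := sub_pos.mpr hu
    rw [fOmega_eq_one_add hu0.ne' hvu.ne']
    exact lt_add_of_pos_right 1 (by positivity)
  · have hr1 : 0 < r - 1 := sub_pos.mpr hr
    have hpos : 0 < 1 / (2 * (r - 1)) := by positivity
    refine ⟨2, 2 + 1 / (2 * (r - 1)), by norm_num, by linarith, ?_⟩
    rw [fOmega_eq_one_add two_ne_zero (by linarith), add_sub_cancel_left]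
    field_simp
    ring
end

section
/- For any real numbers x, y, z with 0 < x < y < z, there exist real numbers r, θ ∈ (1,∞) such that ∫ (1/s) dξ_{x,y,z}(s) = r/x² and ∫ (1/s²) dξ_{x,y,z}(s) = θ·r²/x⁴. -/
open MeasureTheory

theorem integral_two_point {p u v : ℝ} (hp : 0 ≤ p) (hp1 : p ≤ 1) (f : ℝ → ℝ) :
    ∫ s, f s ∂(ENNReal.ofReal p • Measure.dirac u + ENNReal.ofReal (1 - p) • Measure.dirac v) =
      p * f u + (1 - p) * f v := by
  rw [integral_add_measure, integral_smul_measure, integral_smul_measure, integral_dirac,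
    integral_dirac, ENNReal.toReal_ofReal hp, ENNReal.toReal_ofReal (by linarith),
    smul_eq_mul, smul_eq_mul]
  all_goals exact (integrable_dirac enorm_lt_top).smul_measure ENNReal.ofReal_ne_top

theorem s0_s1_bounds {x y z : ℝ} (hx : 0 < x) (hxy : x < y) (hyz : y < z) :
    0 < s0 x y z ∧ s0 x y z < x ^ 2 ∧ x ^ 2 < s1 x y z := by
  have hab : 0 < y ^ 2 - x ^ 2 := by nlinarith
  have hbc : 0 < z ^ 2 - y ^ 2 := by nlinarith
  have hy : 0 < y := hx.trans hxy
  have h0 : psi0 x y z < 0 := by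
    have : 0 < x ^ 2 * y ^ 2 * (z ^ 2 - y ^ 2) / (y ^ 2 - x ^ 2) := by positivity
    unfold psi0
    linarith
  have h1 : 0 < psi1 x y z :=
    div_pos (mul_pos (by positivity) (by linarith)) hab
  have hf : x ^ 4 - psi1 x y z * x ^ 2 - psi0 x y z = -(x ^ 2 * (y ^ 2 - x ^ 2)) := by
    unfold psi0 psi1
    field_simp
    ring
  have hneg : 0 < x ^ 2 * (y ^ 2 - x ^ 2) := by positivity
  have habs : |2 * x ^ 2 - psi1 x y z| < √((psi1 x y z) ^ 2 + 4 * psi0 x y z) := by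
    apply Real.lt_sqrt_of_sq_lt
    rw [sq_abs]
    nlinarith
  have hlt : √((psi1 x y z) ^ 2 + 4 * psi0 x y z) < psi1 x y z := by
    rw [Real.sqrt_lt' h1]
    linarith
  obtain ⟨hl, hr⟩ := abs_lt.mp habs
  unfold s0 s1
  refine ⟨?_, ?_, ?_⟩ <;> linarith

theorem sq_mean_lt_mean_sq {p α β : ℝ} (hp : 0 < p) (hp1 : p < 1) (h : α ≠ β) :
    (p * α + (1 - p) * β) ^ 2 < p * α ^ 2 + (1 - p) * β ^ 2 := by
  have h1 : 0 < 1 - p := sub_pos.mpr hp1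
  have h2 : 0 < (α - β) ^ 2 := sq_pos_of_ne_zero (sub_ne_zero.mpr h)
  have h3 : 0 < p * (1 - p) * (α - β) ^ 2 := by positivity
  linear_combination h3

theorem stmt10 (x y z : ℝ) (hx : 0 < x) (hxy : x < y) (hyz : y < z) :
    ∃ r θ : ℝ, 1 < r ∧ 1 < θ ∧
      (∫ s, 1 / s ∂(xi x y z)) = r / x^2 ∧
      (∫ s, 1 / s^2 ∂(xi x y z)) = θ * r^2 / x^4 := by
  obtain ⟨hu, hua, hav⟩ := s0_s1_bounds hx hxy hyz
  have hρ : rho x y z = (s1 x y z - x ^ 2) / (s1 x y z - s0 x y z) := rfl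
  unfold xi
  generalize s0 x y z = u at *
  generalize s1 x y z = v at *
  generalize rho x y z = p at *
  have hv : 0 < v := by linarith [sq_nonneg x]
  have huv : 0 < v - u := by linarith
  have hp : 0 < p := hρ ▸ div_pos (by linarith) huv
  have hp1 : p < 1 := by
    rw [hρ, div_lt_one huv]
    linarith
  rw [integral_two_point hp.le hp1.le, integral_two_point hp.le hp1.le]
  have hmean : p * (1 / u) + (1 - p) * (1 / v) = (u + v - x ^ 2) / (u * v) := by
    rw [hρ]
    field_simp
    ring
  have hvar := sq_mean_lt_mean_sq (α := 1 / u) (β := 1 / v) hp hp1 (by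
    rw [Ne, one_div, one_div, inv_inj]
    linarith)
  have hm : 0 < p * (1 / u) + (1 - p) * (1 / v) := by
    have := sub_pos.mpr hp1
    positivity
  have hr : 1 < (p * (1 / u) + (1 - p) * (1 / v)) * x ^ 2 := by
    rw [hmean, div_mul_eq_mul_div, one_lt_div (by positivity)]
    nlinarith [mul_pos (sub_pos.mpr hua) (sub_pos.mpr hav)]
  simp only [div_pow, one_pow] at hvar
  generalize p * (1 / u) + (1 - p) * (1 / v) = m at *
  generalize p * (1 / u ^ 2) + (1 - p) * (1 / v ^ 2) = q at *
  refine ⟨m * x ^ 2, q / m ^ 2, hr, ?_, ?_, ?_⟩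
  · rwa [one_lt_div (by positivity)]
  · field_simp
  · field_simp
end

section
/- For any real number x > 0 and any real numbers r, θ ∈ (1,∞), there exist real numbers y, z with x < y < z such that ∫ (1/s) dξ_{x,y,z}(s) = r/x² and ∫ (1/s²) dξ_{x,y,z}(s) = θ·r²/x⁴. -/
open MeasureTheory

theorem integral_ofReal_smul_dirac_add_s11 {w s t : ℝ} (hw₀ : 0 ≤ w) (hw₁ : w ≤ 1) (f : ℝ → ℝ) :
    (∫ u, f u ∂(ENNReal.ofReal w • Measure.dirac s +
      ENNReal.ofReal (1 - w) • Measure.dirac t)) = w * f s + (1 - w) * f t := by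
  have hint (v c : ℝ) : Integrable f (ENNReal.ofReal v • Measure.dirac c) :=
    (integrable_dirac (by simp)).smul_measure ENNReal.ofReal_ne_top
  rw [integral_add_measure (hint _ _) (hint _ _), integral_smul_measure, integral_smul_measure,
    integral_dirac, integral_dirac, ENNReal.toReal_ofReal hw₀,
    ENNReal.toReal_ofReal (sub_nonneg.2 hw₁), smul_eq_mul, smul_eq_mul]

/-- The negative moments of `xi x y z` in terms of the coefficients of the quadratic
`s ^ 2 - psi1 * s - psi0`, whose roots are separated by `x ^ 2`. -/
theorem integral_inv_xi {x y z : ℝ} (hx : 0 < x) (h₀ : psi0 x y z < 0)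
    (h : (x ^ 2) ^ 2 < psi1 x y z * x ^ 2 + psi0 x y z) :
    (∫ s, 1 / s ∂(xi x y z)) = (x ^ 2 - psi1 x y z) / psi0 x y z ∧
    (∫ s, 1 / s ^ 2 ∂(xi x y z)) =
      (1 - psi1 x y z * ((x ^ 2 - psi1 x y z) / psi0 x y z)) / psi0 x y z := by
  have ha : 0 < x ^ 2 := by positivity
  have hp : 0 < psi1 x y z := by
    by_contra! hp
    nlinarith [mul_nonneg (neg_nonneg.2 hp) ha.le, sq_nonneg (x ^ 2)]
  have hs0 : s0 x y z = (psi1 x y z - √(psi1 x y z ^ 2 + 4 * psi0 x y z)) / 2 := rfl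
  have hs1 : s1 x y z = (psi1 x y z + √(psi1 x y z ^ 2 + 4 * psi0 x y z)) / 2 := rfl
  have hdisc : (2 * x ^ 2 - psi1 x y z) ^ 2 < psi1 x y z ^ 2 + 4 * psi0 x y z := by linarith
  have hsqrt := Real.sq_sqrt ((sq_nonneg _).trans hdisc.le)
  have habs := abs_lt.1 (Real.lt_sqrt_of_sq_lt ((sq_abs _).trans_lt hdisc))
  have hlt : √(psi1 x y z ^ 2 + 4 * psi0 x y z) < psi1 x y z :=
    (Real.sqrt_lt' hp).2 (by linarith)
  have hs0_pos : 0 < s0 x y z := by linarith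
  have hs0_lt : s0 x y z < x ^ 2 := by linarith
  have hs1_gt : x ^ 2 < s1 x y z := by linarith
  have hs1_pos : 0 < s1 x y z := ha.trans hs1_gt
  have hsum : psi1 x y z = s0 x y z + s1 x y z := by linarith
  have hprod : psi0 x y z = -(s0 x y z * s1 x y z) := by rw [hs0, hs1]; linarith
  have hsub : 0 < s1 x y z - s0 x y z := by linarith
  have hrho₀ : 0 ≤ rho x y z := div_nonneg (by linarith) hsub.le
  have hrho₁ : rho x y z ≤ 1 := (div_le_one hsub).2 (by linarith)
  rw [xi, integral_ofReal_smul_dirac_add_s11 hrho₀ hrho₁, integral_ofReal_smul_dirac_add_s11 hrho₀ hrho₁,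
    hsum, hprod, rho]
  constructor
  · field_simp
    ring
  · field_simp
    ring

theorem stmt11 (x r θ : ℝ) (hx : 0 < x) (hr : 1 < r) (hθ : 1 < θ) :
    ∃ y z : ℝ, x < y ∧ y < z ∧
      (∫ s, 1 / s ∂(xi x y z)) = r / x^2 ∧
      (∫ s, 1 / s^2 ∂(xi x y z)) = θ * r^2 / x^4 := by
  have hr₀ : 0 < r := by linarith
  have hr₁ : 0 < r - 1 := by linarith
  have hθ₁ : 0 < θ - 1 := by linarith
  obtain ⟨q, hq⟩ : ∃ q, q = (r - 1) / (r ^ 2 * (θ - 1)) := ⟨_, rfl⟩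
  have hq₀ : 0 < q := hq ▸ by positivity
  have hqθ : q * r ^ 2 * (θ - 1) = r - 1 := by rw [hq]; field_simp
  obtain ⟨b, hb⟩ : ∃ b, b = 1 + q * (r - 1) := ⟨_, rfl⟩
  have hb₁ : 1 < b := by nlinarith
  have hb₀ : 0 < b := by linarith
  obtain ⟨c, hc⟩ : ∃ c, c = 1 + q * r - q / b := ⟨_, rfl⟩
  have hbc : b < c := by
    have : q / b < q := div_lt_self hq₀ hb₁
    linarith
  have hc₀ : 0 < c := by linarith
  have hcb : c * b = (1 + q * r) * b - q := by rw [hc]; field_simp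
  have hy : (x * √b) ^ 2 = x ^ 2 * b := by rw [mul_pow, Real.sq_sqrt hb₀.le]
  have hz : (x * √c) ^ 2 = x ^ 2 * c := by rw [mul_pow, Real.sq_sqrt hc₀.le]
  have hden : x ^ 2 * b - x ^ 2 = x ^ 2 * (b - 1) := by ring
  have hb_sub : 0 < b - 1 := by linarith
  have h₀ : psi0 x (x * √b) (x * √c) = -(x ^ 4 * q) := by
    rw [psi0, hy, hz, hden, neg_inj, div_eq_iff (by positivity)]
    have : b * (c - b) = q * (b - 1) := by linear_combination hcb - b * hb
    linear_combination x ^ 6 * this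
  have h₁ : psi1 x (x * √b) (x * √c) = x ^ 2 * (1 + q * r) := by
    rw [psi1, hy, hz, hden, div_eq_iff (by positivity)]
    have : b * (c - 1) = (1 + q * r) * (b - 1) := by linear_combination hcb - hb
    linear_combination x ^ 4 * this
  obtain ⟨h_one, h_two⟩ := integral_inv_xi (x := x) (y := x * √b) (z := x * √c) hx
    (by rw [h₀]; linarith [show 0 < x ^ 4 * q by positivity])
    (by rw [h₀, h₁]; linarith [show 0 < x ^ 4 * (q * (r - 1)) by positivity])
  have hinv : (x ^ 2 - x ^ 2 * (1 + q * r)) / -(x ^ 4 * q) = r / x ^ 2 := by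
    field_simp
    ring
  refine ⟨x * √b, x * √c, ?_, ?_, ?_, ?_⟩
  · exact lt_mul_of_one_lt_right hx (Real.lt_sqrt_of_sq_lt (by linarith))
  · exact mul_lt_mul_of_pos_left (Real.sqrt_lt_sqrt hb₀.le hbc) hx
  · rw [h_one, h₀, h₁, hinv]
  · rw [h_two, h₀, h₁, hinv, div_eq_div_iff (neg_ne_zero.2 (by positivity)) (by positivity)]
    field_simp
    linear_combination hqθ
end

section
/- Let μ = t·δ_a + (1−t)·δ_b be a Borel probability measure on ℝ, where 0 < a < b and 0 < t < 1 and δ_c denotes the Dirac measure at c. Set m = ∫ s dμ(s), P = ∫ (1/s) dμ(s) and Q = ∫ (1/s²) dμ(s). Then m·P > 1 and Q > P², and, setting r = m·P and θ = Q/P² (so that r > 1 and θ > 1), the sum of the two atoms satisfies a + b = m·(θr − 1)/((θ−1)r) = (m·Q − P)/(Q − P²). -/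
open MeasureTheory

theorem integral_two_point_mixture (a b t : ℝ) (ht0 : 0 ≤ t) (ht1 : t ≤ 1) (f : ℝ → ℝ) :
    ∫ s, f s ∂(ENNReal.ofReal t • Measure.dirac a +
      ENNReal.ofReal (1 - t) • Measure.dirac b) = t * f a + (1 - t) * f b := by
  have integrable_smul_dirac (c u : ℝ) :
      Integrable f (ENNReal.ofReal u • Measure.dirac c) :=
    (integrable_dirac (by simp)).smul_measure ENNReal.ofReal_ne_top
  rw [integral_add_measure (integrable_smul_dirac a t) (integrable_smul_dirac b (1 - t)),
    integral_smul_measure, integral_smul_measure, integral_dirac, integral_dirac,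
    ENNReal.toReal_ofReal ht0, ENNReal.toReal_ofReal (sub_nonneg.mpr ht1), smul_eq_mul,
    smul_eq_mul]

theorem stmt13 (a b t : ℝ) (ha : 0 < a) (hab : a < b) (ht0 : 0 < t) (ht1 : t < 1)
    (μ : Measure ℝ)
    (hμ : μ = ENNReal.ofReal t • Measure.dirac a +
      ENNReal.ofReal (1 - t) • Measure.dirac b)
    (m P Q r θ : ℝ)
    (hm : m = ∫ s, s ∂μ) (hP : P = ∫ s, 1 / s ∂μ) (hQ : Q = ∫ s, 1 / s^2 ∂μ)
    (hr : r = m * P) (hθ : θ = Q / P^2) :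
    1 < m * P ∧ P^2 < Q ∧
    a + b = m * (θ*r - 1) / ((θ - 1) * r) ∧
    a + b = (m * Q - P) / (Q - P^2) := by
  rw [hμ, integral_two_point_mixture a b t ht0.le ht1.le] at hm hP hQ
  have hb : 0 < b := ha.trans hab
  have h1t : 0 < 1 - t := sub_pos.mpr ht1
  have hba : 0 < b - a := sub_pos.mpr hab
  have hm0 : 0 < m := by rw [hm]; positivity
  have hP0 : 0 < P := by rw [hP]; positivity
  have hmP : m * P - 1 = t * (1 - t) * (b - a)^2 / (a * b) := by
    rw [hm, hP]; field_simp; ring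
  have hQP : Q - P^2 = t * (1 - t) * (b - a)^2 / (a * b)^2 := by
    rw [hQ, hP]; field_simp; ring
  have hmQ : (a + b) * (Q - P^2) = m * Q - P := by
    rw [hm, hQ, hP]; field_simp; ring
  have hmP_pos : 0 < m * P - 1 := by rw [hmP]; positivity
  have hQP_pos : 0 < Q - P^2 := by rw [hQP]; positivity
  have hab_eq : a + b = (m * Q - P) / (Q - P^2) := by
    rw [eq_div_iff hQP_pos.ne', hmQ]
  refine ⟨sub_pos.mp hmP_pos, sub_pos.mp hQP_pos, ?_, hab_eq⟩
  have hθ1 : θ - 1 = (Q - P^2) / P^2 := by rw [hθ]; field_simp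
  rw [hab_eq, hθ1, hθ, hr]
  field_simp
end

section
/- Let λ₀ > 0 and let (λ_{i,1})_{i∈ℕ} and (λ_{i,2})_{i∈ℕ} be sequences of positive real numbers. Then the following are equivalent: (a) there exist sequences (t_i)_{i∈ℕ} ⊆ (0,1) and (a_i)_{i∈ℕ}, (b_i)_{i∈ℕ} of reals with 0 < a_i < b_i for all i, such that the probability measures μ_i = t_i·δ_{a_i} + (1−t_i)·δ_{b_i} satisfy ∫ s dμ_i(s) = λ_{i,2}² for every i, sup_i b_i < ∞, Σ_{i∈ℕ} λ_{i,1}² ∫ (1/s) dμ_i(s) = 1, and Σ_{i∈ℕ} λ_{i,1}² ∫ (1/s²) dμ_i(s) ≤ 1/λ₀²; (b) there exist sequences (r_i)_{i∈ℕ}, (θ_i)_{i∈ℕ} ⊆ (1,∞) such that sup_i [((θ_i r_i − 1)/((θ_i − 1)r_i))·λ_{i,2}²] < ∞, Σ_{i∈ℕ} r_i·λ_{i,1}²/λ_{i,2}² = 1, and Σ_{i∈ℕ} θ_i·r_i²·λ_{i,1}²/λ_{i,2}⁴ ≤ 1/λ₀². -/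
open MeasureTheory

/-- The 2-atomic probability measure `t·δ_a + (1−t)·δ_b`. -/
noncomputable def mu2 (t a b : ℝ) : Measure ℝ :=
  ENNReal.ofReal t • Measure.dirac a + ENNReal.ofReal (1 - t) • Measure.dirac b

/-- Integrals against `mu2` are convex combinations of the values at the two atoms. -/
theorem integral_mu2 (f : ℝ → ℝ) {t : ℝ} (ht0 : 0 ≤ t) (ht1 : t ≤ 1) (a b : ℝ) :
    ∫ s, f s ∂(mu2 t a b) = t * f a + (1 - t) * f b := by
  have h (c : ℝ) : Integrable f (Measure.dirac c) := integrable_dirac (by simp)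
  rw [mu2, integral_add_measure ((h a).smul_measure ENNReal.ofReal_ne_top)
    ((h b).smul_measure ENNReal.ofReal_ne_top), integral_smul_measure, integral_smul_measure,
    integral_dirac, integral_dirac, ENNReal.toReal_ofReal ht0,
    ENNReal.toReal_ofReal (sub_nonneg.2 ht1), smul_eq_mul, smul_eq_mul]

/-- The negative moments of a 2-atomic measure with mean `m` have the form `r / m` and
`θ * r ^ 2 / m ^ 2` with `r, θ > 1`, and the sum of the atoms is a function of `r`, `θ`, `m`. -/
theorem exists_ratios_of_atoms {t a b m : ℝ} (ht0 : 0 < t) (ht1 : t < 1) (ha : 0 < a)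
    (hab : a < b) (hm : t * a + (1 - t) * b = m) :
    ∃ r θ : ℝ, 1 < r ∧ 1 < θ ∧ (θ * r - 1) / ((θ - 1) * r) * m = a + b ∧
      t * (1 / a) + (1 - t) * (1 / b) = r / m ∧
      t * (1 / a ^ 2) + (1 - t) * (1 / b ^ 2) = θ * r ^ 2 / m ^ 2 := by
  have hb : 0 < b := ha.trans hab
  have hu : 0 < 1 - t := sub_pos.2 ht1
  have hd : 0 < b - a := sub_pos.2 hab
  have hm0 : 0 < m := by rw [← hm]; positivity
  set n : ℝ := t * b + (1 - t) * a with hn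
  have hn0 : 0 < n := by positivity
  set k : ℝ := t * b ^ 2 + (1 - t) * a ^ 2 with hk
  have hr : m * n - a * b = t * (1 - t) * (b - a) ^ 2 := by rw [← hm, hn]; ring
  have hθ : k - n ^ 2 = t * (1 - t) * (b - a) ^ 2 := by rw [hn, hk]; ring
  have hpos : 0 < t * (1 - t) * (b - a) ^ 2 := by positivity
  have hsum : k * m - a * b * n = (a + b) * (t * (1 - t) * (b - a) ^ 2) := by
    rw [← hm, hn, hk]; ring
  refine ⟨m * n / (a * b), k / n ^ 2, ?_, ?_, ?_, ?_, ?_⟩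
  · rw [one_lt_div (by positivity)]; linarith
  · rw [one_lt_div (by positivity)]; linarith
  · have h₁ : k / n ^ 2 * (m * n / (a * b)) - 1 = (k * m - a * b * n) / (n * (a * b)) := by
      field_simp
    have h₂ : k / n ^ 2 - 1 = (k - n ^ 2) / n ^ 2 := by field_simp
    rw [h₁, h₂, hsum, hθ]
    field_simp
  · rw [hn]; field_simp
  · rw [hk]; field_simp

/-- Conversely, every pair `r, θ > 1` arises from a 2-atomic measure with mean `m`. -/
theorem exists_atoms_of_ratios {r θ m : ℝ} (hr : 1 < r) (hθ : 1 < θ) (hm : 0 < m) :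
    ∃ t a b : ℝ, 0 < t ∧ t < 1 ∧ 0 < a ∧ a < b ∧ t * a + (1 - t) * b = m ∧
      a + b = (θ * r - 1) / ((θ - 1) * r) * m ∧
      t * (1 / a) + (1 - t) * (1 / b) = r / m ∧
      t * (1 / a ^ 2) + (1 - t) * (1 / b ^ 2) = θ * r ^ 2 / m ^ 2 := by
  have hp : 0 < θ - 1 := sub_pos.2 hθ
  have hq : 0 < r - 1 := sub_pos.2 hr
  have hr0 : 0 < r := by linarith
  have hs : 0 < θ * r - 1 := by nlinarith
  set K : ℝ := (θ * r - 1) / ((θ - 1) * r) * m with hK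
  set P : ℝ := (r - 1) / ((θ - 1) * r ^ 2) * m ^ 2 with hP
  have hK0 : 0 < K := by positivity
  have hP0 : 0 < P := by positivity
  have hdisc : 0 < K ^ 2 - 4 * P := by
    have h : K ^ 2 - 4 * P =
        ((θ * r - 1) ^ 2 - 4 * (r - 1) * (θ - 1)) / ((θ - 1) * r) ^ 2 * m ^ 2 := by
      rw [hK, hP]; field_simp
    have h' : 0 < (θ * r - 1) ^ 2 - 4 * (r - 1) * (θ - 1) := by
      have : (θ * r - 1) ^ 2 - 4 * (r - 1) * (θ - 1) = ((θ - 1) - (r - 1)) ^ 2 +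
          ((θ - 1) * (r - 1)) ^ 2 + 2 * ((θ - 1) * (r - 1)) * ((θ - 1) + (r - 1)) := by ring
      rw [this]; positivity
    rw [h]; positivity
  set w : ℝ := √(K ^ 2 - 4 * P) with hw
  have hw0 : 0 < w := Real.sqrt_pos.2 hdisc
  have hw2 : w ^ 2 = K ^ 2 - 4 * P := Real.sq_sqrt hdisc.le
  have hwK : w < K := by nlinarith
  obtain ⟨a, ha⟩ : ∃ a, a = (K - w) / 2 := ⟨_, rfl⟩
  obtain ⟨b, hb⟩ : ∃ b, b = (K + w) / 2 := ⟨_, rfl⟩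
  have hadd : a + b = K := by rw [ha, hb]; ring
  have hmul : a * b = P := by rw [ha, hb]; linear_combination -hw2 / 4
  have ha0 : 0 < a := by rw [ha]; linarith
  have hab : a < b := by rw [ha, hb]; linarith
  have hb0 : 0 < b := ha0.trans hab
  have hval : (m - a) * (m - b) < 0 := by
    have h : (m - a) * (m - b) = -((r - 1) ^ 2 / ((θ - 1) * r ^ 2) * m ^ 2) := by
      have : (m - a) * (m - b) = m ^ 2 - K * m + P := by rw [← hadd, ← hmul]; ring
      rw [this, hK, hP]; field_simp; ring
    rw [h, neg_lt_zero]; positivity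
  have ham : a < m := by by_contra! h; nlinarith
  have hmb : m < b := by by_contra! h; nlinarith
  have hd : 0 < b - a := sub_pos.2 hab
  have hu : 1 - (b - m) / (b - a) = (m - a) / (b - a) := by field_simp; ring
  have hE₁ : (K - m) / P = r / m := by
    rw [hK, hP]; field_simp; ring
  have hE₂ : (K * (r / m) - 1) / P = θ * r ^ 2 / m ^ 2 := by
    rw [hK, hP]; field_simp; ring
  have h₁ : (b - m) / (b - a) * (1 / a) + (m - a) / (b - a) * (1 / b) = r / m := by
    rw [← hE₁, ← hadd, ← hmul]; field_simp; ring
  refine ⟨(b - m) / (b - a), a, b, div_pos (by linarith) hd, (div_lt_one hd).2 (by linarith),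
    ha0, hab, ?_, hadd, ?_, ?_⟩
  · rw [hu]; field_simp; ring
  · rw [hu, h₁]
  · rw [hu, ← hE₂, ← h₁, ← hadd, ← hmul]; field_simp; ring

theorem stmt14 (lam0 : ℝ) (hlam0 : 0 < lam0) (l1 l2 : ℕ → ℝ)
    (hl1 : ∀ i, 0 < l1 i) (hl2 : ∀ i, 0 < l2 i) :
    (∃ t a b : ℕ → ℝ,
      (∀ i, 0 < t i ∧ t i < 1) ∧
      (∀ i, 0 < a i ∧ a i < b i) ∧
      (∀ i, ∫ s, s ∂(mu2 (t i) (a i) (b i)) = (l2 i)^2) ∧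
      BddAbove (Set.range b) ∧
      Summable (fun i => (l1 i)^2 * ∫ s, 1 / s ∂(mu2 (t i) (a i) (b i))) ∧
      (∑' i, (l1 i)^2 * ∫ s, 1 / s ∂(mu2 (t i) (a i) (b i))) = 1 ∧
      Summable (fun i => (l1 i)^2 * ∫ s, 1 / s^2 ∂(mu2 (t i) (a i) (b i))) ∧
      (∑' i, (l1 i)^2 * ∫ s, 1 / s^2 ∂(mu2 (t i) (a i) (b i))) ≤ 1 / lam0^2) ↔
    (∃ r θ : ℕ → ℝ,
      (∀ i, 1 < r i) ∧ (∀ i, 1 < θ i) ∧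
      BddAbove (Set.range fun i => (θ i * r i - 1) / ((θ i - 1) * r i) * (l2 i)^2) ∧
      Summable (fun i => r i * (l1 i)^2 / (l2 i)^2) ∧
      (∑' i, r i * (l1 i)^2 / (l2 i)^2) = 1 ∧
      Summable (fun i => θ i * (r i)^2 * (l1 i)^2 / (l2 i)^4) ∧
      (∑' i, θ i * (r i)^2 * (l1 i)^2 / (l2 i)^4) ≤ 1 / lam0^2) := by
  constructor
  · rintro ⟨t, a, b, ht, hab, hmean, ⟨B, hB⟩, hs₁, ht₁, hs₂, ht₂⟩
    simp only [fun (f : ℝ → ℝ) i =>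
      integral_mu2 f (ht i).1.le (ht i).2.le (a i) (b i)] at hmean hs₁ ht₁ hs₂ ht₂
    choose r θ hr hθ hK h₁ h₂ using fun i =>
      exists_ratios_of_atoms (ht i).1 (ht i).2 (hab i).1 (hab i).2 (hmean i)
    have e₁ (i : ℕ) : (l1 i) ^ 2 * (t i * (1 / a i) + (1 - t i) * (1 / b i)) =
        r i * (l1 i) ^ 2 / (l2 i) ^ 2 := by rw [h₁ i]; ring
    have e₂ (i : ℕ) : (l1 i) ^ 2 * (t i * (1 / (a i) ^ 2) + (1 - t i) * (1 / (b i) ^ 2)) =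
        θ i * (r i) ^ 2 * (l1 i) ^ 2 / (l2 i) ^ 4 := by rw [h₂ i]; ring
    simp only [e₁] at hs₁ ht₁
    simp only [e₂] at hs₂ ht₂
    refine ⟨r, θ, hr, hθ, ⟨2 * B, ?_⟩, hs₁, ht₁, hs₂, ht₂⟩
    rintro _ ⟨i, rfl⟩
    have := hB ⟨i, rfl⟩
    have := (hab i).2
    simp only [hK i]
    linarith
  · rintro ⟨r, θ, hr, hθ, ⟨B, hB⟩, hs₁, ht₁, hs₂, ht₂⟩
    choose t a b ht₀ ht' ha hab hmean hK h₁ h₂ using fun i =>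
      exists_atoms_of_ratios (hr i) (hθ i) (pow_pos (hl2 i) 2)
    have e₁ (i : ℕ) : (l1 i) ^ 2 * (t i * (1 / a i) + (1 - t i) * (1 / b i)) =
        r i * (l1 i) ^ 2 / (l2 i) ^ 2 := by rw [h₁ i]; ring
    have e₂ (i : ℕ) : (l1 i) ^ 2 * (t i * (1 / (a i) ^ 2) + (1 - t i) * (1 / (b i) ^ 2)) =
        θ i * (r i) ^ 2 * (l1 i) ^ 2 / (l2 i) ^ 4 := by rw [h₂ i]; ring
    refine ⟨t, a, b, fun i => ⟨ht₀ i, ht' i⟩, fun i => ⟨ha i, hab i⟩, ?_⟩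
    simp only [fun (f : ℝ → ℝ) i => integral_mu2 f (ht₀ i).le (ht' i).le (a i) (b i), e₁, e₂]
    refine ⟨hmean, ⟨B, ?_⟩, hs₁, ht₁, hs₂, ht₂⟩
    rintro _ ⟨i, rfl⟩
    have := hB ⟨i, rfl⟩
    have := ha i
    have := hK i
    simp only at *
    linarith
end

section
/- Let η ≥ 2 be a natural number, let λ₀ > 0 and let λ_{1,1},…,λ_{η,1} and λ_{1,2},…,λ_{η,2} be positive real numbers. Then there exist r_1,…,r_η ∈ (1,∞) with Σ_{i=1}^{η} r_i·λ_{i,1}²/λ_{i,2}² = 1 and Σ_{i=1}^{η} r_i²·λ_{i,1}²/λ_{i,2}⁴ < 1/λ₀², provided any of the following conditions holds: (i) Σ_{i=1}^{η} λ_{i,1}²/λ_{i,2}² < 1 and λ₀²·Σ_{i=1}^{η} λ_{i,1}²/λ_{i,2}⁴ < (Σ_{i=1}^{η} λ_{i,1}²/λ_{i,2}²)²; (ii) η·λ_{i,1}² < λ_{i,2}² for each i and λ₀²·Σ_{i=1}^{η} 1/λ_{i,1}² < η²; (iii) λ_{i,1}²·Σ_{j=1}^{η} 1/λ_{j,2}²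 < 1 for each i and λ₀²·Σ_{i=1}^{η} 1/(λ_{i,1}²·λ_{i,2}⁴) < (Σ_{i=1}^{η} 1/λ_{i,2}²)². -/
theorem stmt17 (η : ℕ) (hη : 2 ≤ η) (lam0 : ℝ) (hlam0 : 0 < lam0)
    (l1 l2 : Fin η → ℝ) (hl1 : ∀ i, 0 < l1 i) (hl2 : ∀ i, 0 < l2 i)
    (h : ((∑ i, (l1 i)^2 / (l2 i)^2) < 1 ∧
            lam0^2 * ∑ i, (l1 i)^2 / (l2 i)^4 < (∑ i, (l1 i)^2 / (l2 i)^2)^2) ∨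
         ((∀ i, (η : ℝ) * (l1 i)^2 < (l2 i)^2) ∧
            lam0^2 * ∑ i, 1 / (l1 i)^2 < (η : ℝ)^2) ∨
         ((∀ i, (l1 i)^2 * ∑ j, 1 / (l2 j)^2 < 1) ∧
            lam0^2 * ∑ i, 1 / ((l1 i)^2 * (l2 i)^4) < (∑ i, 1 / (l2 i)^2)^2)) :
    ∃ r : Fin η → ℝ, (∀ i, 1 < r i) ∧
      (∑ i, r i * (l1 i)^2 / (l2 i)^2) = 1 ∧
      (∑ i, (r i)^2 * (l1 i)^2 / (l2 i)^4) < 1 / lam0^2 := by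
  have : NeZero η := ⟨by omega⟩
  have lt_one_div_sq {B T : ℝ} (hT : 0 < T) (hB : lam0 ^ 2 * B < T ^ 2) :
      B / T ^ 2 < 1 / lam0 ^ 2 := by
    rw [div_lt_div_iff₀ (by positivity) (by positivity)]
    linarith
  rcases h with ⟨hS, hB⟩ | ⟨hS, hB⟩ | ⟨hS, hB⟩
  · set S := ∑ i, (l1 i)^2 / (l2 i)^2 with hSdef
    have hS0 : 0 < S := Finset.sum_pos
      (fun i _ => by have := hl1 i; have := hl2 i; positivity) Finset.univ_nonempty
    refine ⟨fun _ => 1 / S, fun _ => (one_lt_div hS0).2 hS, ?_, ?_⟩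
    · simp_rw [mul_div_assoc]
      rw [← Finset.mul_sum, ← hSdef, one_div_mul_cancel hS0.ne']
    · refine lt_of_eq_of_lt ?_ (lt_one_div_sq hS0 hB)
      rw [Finset.sum_div]
      refine Finset.sum_congr rfl fun i _ => ?_
      have := hl2 i
      field_simp
  · have hη0 : (0 : ℝ) < η := by positivity
    refine ⟨fun i => (l2 i)^2 / (η * (l1 i)^2), fun i => ?_, ?_, ?_⟩
    · have := hl1 i
      exact (one_lt_div (by positivity)).2 (hS i)
    · have heq : ∀ i ∈ Finset.univ,
          (l2 i)^2 / (η * (l1 i)^2) * (l1 i)^2 / (l2 i)^2 = 1 / (η : ℝ) := fun i _ => by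
        have := hl1 i
        have := hl2 i
        field_simp
      rw [Finset.sum_congr rfl heq]
      simp [hη0.ne']
    · refine lt_of_eq_of_lt ?_ (lt_one_div_sq hη0 hB)
      rw [Finset.sum_div]
      refine Finset.sum_congr rfl fun i _ => ?_
      have := hl1 i
      have := hl2 i
      field_simp
  · set T := ∑ i, 1 / (l2 i)^2 with hTdef
    have hT0 : 0 < T := Finset.sum_pos
      (fun i _ => by have := hl2 i; positivity) Finset.univ_nonempty
    refine ⟨fun i => 1 / ((l1 i)^2 * T), fun i => ?_, ?_, ?_⟩
    · have := hl1 i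
      exact (one_lt_div (by positivity)).2 (hS i)
    · refine Eq.trans ?_ ((div_eq_one_iff_eq hT0.ne').2 hTdef.symm)
      rw [Finset.sum_div]
      refine Finset.sum_congr rfl fun i _ => ?_
      have := hl1 i
      have := hl2 i
      field_simp
    · refine lt_of_eq_of_lt ?_ (lt_one_div_sq hT0 hB)
      rw [Finset.sum_div]
      refine Finset.sum_congr rfl fun i _ => ?_
      have := hl1 i
      have := hl2 i
      field_simp
end

section
/- Let a_1, a_2, b_1, b_2 be positive real numbers and set σ = a_2/(a_1 + b_1) and τ = a_2(b_2 − b_1)/(a_1·b_2). Let S = {(x,y) ∈ ℝ² : x > 1, y > 1, and (a_1/a_2)x + (b_1/b_2)y = 1} and let β = inf{ (a_1/a_2²)x² + (b_1/b_2²)y² : (x,y) ∈ S }. Then S is nonempty if and only if τ > 1, and in that case β = ((a_1−a_2)² + a_1b_1)/(a_2²·b_1) if σ ≤ 1, β = 1/(a_1 + b_1) if 1 < σ < τ, and β = ((b_2−b_1)² + a_1b_1)/(a_1·b_2²) if τ ≤ σ. -/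
/-- The constraint set of the two-variable minimization: values of the quadratic
form `(a₁/a₂²)x² + (b₁/b₂²)y²` over `x, y > 1` with `(a₁/a₂)x + (b₁/b₂)y = 1`. -/
def quadValues (a1 a2 b1 b2 : ℝ) : Set ℝ :=
  {t : ℝ | ∃ x y : ℝ, 1 < x ∧ 1 < y ∧ a1 / a2 * x + b1 / b2 * y = 1 ∧
    t = a1 / a2^2 * x^2 + b1 / b2^2 * y^2}

/-- On the line `(a₁/a₂)x + (b₁/b₂)y = 1`, the condition `1 < y` is an upper bound on `x`. -/
lemma one_lt_and_eq_one_iff {a1 a2 b1 b2 : ℝ} (ha1 : 0 < a1) (ha2 : 0 < a2) (hb1 : 0 < b1)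
    (hb2 : 0 < b2) (x y : ℝ) :
    (1 < y ∧ a1 / a2 * x + b1 / b2 * y = 1) ↔
      x < a2 * (b2 - b1) / (a1 * b2) ∧ y = (1 - a1 / a2 * x) * (b2 / b1) := by
  have hy : a1 / a2 * x + b1 / b2 * y = 1 ↔ y = (1 - a1 / a2 * x) * (b2 / b1) := by
    constructor
    · intro h
      rw [← h]
      field_simp
      ring
    · rintro rfl
      field_simp
      ring
  rw [hy]
  refine and_congr_left ?_
  rintro rfl
  have h : (1 - a1 / a2 * x) * (b2 / b1) - 1 =
      a1 * b2 / (a2 * b1) * (a2 * (b2 - b1) / (a1 * b2) - x) := by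
    field_simp
    ring
  rw [← sub_pos, h, mul_pos_iff_of_pos_left (by positivity), sub_pos]

/-- Eliminating `y` turns the quadratic form into a parabola with vertex `a₂/(a₁ + b₁)`. -/
lemma quadValues_eq_image {a1 a2 b1 b2 : ℝ} (ha1 : 0 < a1) (ha2 : 0 < a2) (hb1 : 0 < b1)
    (hb2 : 0 < b2) :
    quadValues a1 a2 b1 b2 =
      (fun x => 1 / (a1 + b1) + a1 * (a1 + b1) / (b1 * a2 ^ 2) * (x - a2 / (a1 + b1)) ^ 2) ''
        Set.Ioo 1 (a2 * (b2 - b1) / (a1 * b2)) := by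
  have key (x : ℝ) : 1 / (a1 + b1) + a1 * (a1 + b1) / (b1 * a2 ^ 2) * (x - a2 / (a1 + b1)) ^ 2 =
      a1 / a2 ^ 2 * x ^ 2 + b1 / b2 ^ 2 * ((1 - a1 / a2 * x) * (b2 / b1)) ^ 2 := by
    field_simp
    ring
  ext t
  constructor
  · rintro ⟨x, y, hx, hy, hxy, rfl⟩
    obtain ⟨hx', rfl⟩ := (one_lt_and_eq_one_iff ha1 ha2 hb1 hb2 x y).1 ⟨hy, hxy⟩
    exact ⟨x, ⟨hx, hx'⟩, key x⟩
  · rintro ⟨x, ⟨hx, hx'⟩, rfl⟩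
    obtain ⟨hy, hxy⟩ := (one_lt_and_eq_one_iff ha1 ha2 hb1 hb2 x _).2 ⟨hx', rfl⟩
    exact ⟨x, _, hx, hy, hxy, key x⟩

/-- The infimum of an upward parabola over an open interval is its value at the point of the
closed interval nearest to the vertex. -/
lemma sInf_image_parabola_Ioo {m k s l r z : ℝ} (hk : 0 ≤ k) (hlr : l < r)
    (hz : z ∈ Set.Icc l r) (hmin : ∀ x ∈ Set.Ioo l r, (z - s) ^ 2 ≤ (x - s) ^ 2) :
    sInf ((fun x => m + k * (x - s) ^ 2) '' Set.Ioo l r) = m + k * (z - s) ^ 2 := by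
  have hcont : Continuous fun x : ℝ => m + k * (x - s) ^ 2 := by fun_prop
  refine (isGLB_of_mem_closure ?_ ?_).csInf_eq ((Set.nonempty_Ioo.2 hlr).image _)
  · rintro _ ⟨x, hx, rfl⟩
    have := mul_le_mul_of_nonneg_left (hmin x hx) hk
    dsimp only
    linarith
  · refine image_closure_subset_closure_image hcont ⟨z, ?_, rfl⟩
    rwa [closure_Ioo hlr.ne]

theorem stmt19 (a1 a2 b1 b2 : ℝ)
    (ha1 : 0 < a1) (ha2 : 0 < a2) (hb1 : 0 < b1) (hb2 : 0 < b2) :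
    ((∃ x y : ℝ, 1 < x ∧ 1 < y ∧ a1 / a2 * x + b1 / b2 * y = 1) ↔
      1 < a2 * (b2 - b1) / (a1 * b2)) ∧
    (1 < a2 * (b2 - b1) / (a1 * b2) →
      ((a2 / (a1 + b1) ≤ 1 →
          sInf (quadValues a1 a2 b1 b2) = ((a1 - a2)^2 + a1 * b1) / (a2^2 * b1)) ∧
       (1 < a2 / (a1 + b1) ∧ a2 / (a1 + b1) < a2 * (b2 - b1) / (a1 * b2) →
          sInf (quadValues a1 a2 b1 b2) = 1 / (a1 + b1)) ∧
       (a2 * (b2 - b1) / (a1 * b2) ≤ a2 / (a1 + b1) →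
          sInf (quadValues a1 a2 b1 b2) = ((b2 - b1)^2 + a1 * b1) / (a1 * b2^2)))) := by
  have hk : 0 ≤ a1 * (a1 + b1) / (b1 * a2 ^ 2) := by positivity
  refine ⟨⟨?_, ?_⟩, fun hτ => ?_⟩
  · rintro ⟨x, y, hx, h⟩
    exact hx.trans ((one_lt_and_eq_one_iff ha1 ha2 hb1 hb2 x y).1 h).1
  · intro hτ
    obtain ⟨x, hx, hx'⟩ := exists_between hτ
    exact ⟨x, _, hx, (one_lt_and_eq_one_iff ha1 ha2 hb1 hb2 x _).2 ⟨hx', rfl⟩⟩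
  · rw [quadValues_eq_image ha1 ha2 hb1 hb2]
    refine ⟨fun hσ => ?_, fun hσ => ?_, fun hσ => ?_⟩
    · rw [sInf_image_parabola_Ioo hk hτ (Set.left_mem_Icc.2 hτ.le)]
      · field_simp
        ring
      · intro x hx
        exact pow_le_pow_left₀ (sub_nonneg.2 hσ) (sub_le_sub_right hx.1.le _) 2
    · rw [sInf_image_parabola_Ioo hk hτ ⟨hσ.1.le, hσ.2.le⟩]
      · simp
      · intro x _
        simpa using sq_nonneg (x - a2 / (a1 + b1))
    · rw [sInf_image_parabola_Ioo hk hτ (Set.right_mem_Icc.2 hτ.le)]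
      · field_simp
        ring
      · intro x hx
        rw [sub_sq_comm _ (a2 / (a1 + b1)), sub_sq_comm x]
        exact pow_le_pow_left₀ (sub_nonneg.2 hσ) (sub_le_sub_left hx.2.le _) 2
end
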